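/- If s = x + iy with 1/2 < x < 1 is a zero of the Riemann zeta function, then Σ_{k=1}^∞ (−1)^{k+1} Z_{k+1}(x,y) = 1/2, where Z_{k+1}(x,y) = (1/ζ(2x)) Σ_{n=1}^∞ cos(y log(1 + k/n)) / (n(n+k))^x and the outer series is summed in any ordering under which it converges (e.g., as the limit of rectangular partial sums of the underlying double series). -/

import Mathlib

open Complex Filter Finset Real

lemma aux_diff (a : ℝ) (ha : 0 < a) (s : ℂ) (hs : 0 < s.re) :
    ((a : ℂ) ^ (-s) - ((a + 1 : ℝ) : ℂ) ^ (-s)) = s * ∫ t in a..(a+1), (t : ℂ) ^ (-s - 1) := by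
  have hs0 : s ≠ 0 := by rintro rfl; simp at hs
  rw [integral_cpow]
  · rw [sub_add_cancel]
    field_simp
    ring
  · right
    constructor
    · intro h
      apply hs0
      linear_combination -h
    · rw [Set.uIcc_of_le (by linarith)]
      intro h; linarith [h.1]

lemma aux_bound1 (a : ℝ) (ha : 0 < a) (s : ℂ) (hs : 0 < s.re) :
    ‖(a : ℂ) ^ (-s) - ((a + 1 : ℝ) : ℂ) ^ (-s)‖ ≤ ‖s‖ / s.re * (a ^ (-s.re) - (a + 1) ^ (-s.re)) := by
  rw [aux_diff a ha s hs, norm_mul, div_mul_eq_mul_div, mul_div_assoc]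
  gcongr
  refine (intervalIntegral.norm_integral_le_integral_norm (by linarith)).trans ?_
  have : ∫ t in a..(a+1), ‖(t : ℂ) ^ (-s - 1)‖ = ∫ t in a..(a+1), t ^ (-s.re - 1) := by
    apply intervalIntegral.integral_congr
    intro t ht
    rw [Set.uIcc_of_le (by linarith)] at ht
    simp only
    rw [Complex.norm_cpow_eq_rpow_re_of_pos (by linarith [ht.1])]
    simp
  rw [this, integral_rpow]
  · rw [sub_add_cancel, div_neg, ← neg_div, neg_sub]
  · right
    constructor
    · intro h; linarith
    · rw [Set.uIcc_of_le (by linarith)]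
      intro h; linarith [h.1]

lemma aux_bound2 (a : ℝ) (ha : 0 < a) (s : ℂ) (hs : 0 < s.re) :
    ‖(a : ℂ) ^ (-s) - ((a + 1 : ℝ) : ℂ) ^ (-s)‖ ≤ ‖s‖ * a ^ (-s.re - 1) := by
  rw [aux_diff a ha s hs, norm_mul]
  gcongr
  refine (intervalIntegral.norm_integral_le_of_norm_le_const (C := a ^ (-s.re - 1)) ?_).trans ?_
  · intro t ht
    rw [Set.uIoc_of_le (by linarith)] at ht
    rw [Complex.norm_cpow_eq_rpow_re_of_pos (by linarith [ht.1])]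
    simp only [sub_re, neg_re, one_re]
    exact Real.rpow_le_rpow_of_nonpos ha ht.1.le (by linarith)
  · simp

noncomputable def dd (m : ℕ) (s : ℂ) : ℂ :=
  ((2 * m + 1 : ℝ) : ℂ) ^ (-s) - ((2 * m + 1 + 1 : ℝ) : ℂ) ^ (-s)

lemma dd_summable_bound (δ : ℝ) (hδ : 0 < δ) (B : ℝ) :
    Summable (fun m : ℕ => B * (2 * (m : ℝ) + 1) ^ (-δ - 1)) := by
  apply Summable.mul_left
  have h := (Real.summable_nat_rpow (p := -δ - 1)).2 (by linarith)
  have h2 := h.comp_injective (i := fun m : ℕ => 2 * m + 1) (fun a b h => by simpa using h)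
  refine h2.congr fun m => ?_
  simp

lemma dd_bound (δ : ℝ) (hδ : 0 < δ) (B : ℝ) (m : ℕ) (s : ℂ) (h1 : δ < s.re) (h2 : ‖s‖ < B) :
    ‖dd m s‖ ≤ B * (2 * (m : ℝ) + 1) ^ (-δ - 1) := by
  refine (aux_bound2 (2 * m + 1) (by positivity) s (by linarith)).trans ?_
  have hB : 0 ≤ B := (norm_nonneg s).trans h2.le
  have hm : (1 : ℝ) ≤ 2 * (m : ℝ) + 1 := by linarith [Nat.cast_nonneg (α := ℝ) m]
  gcongr

lemma dd_summable (s : ℂ) (hs : 0 < s.re) : Summable (fun m => dd m s) :=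
  Summable.of_norm_bounded (dd_summable_bound (s.re / 2) (by linarith) (‖s‖ + 1))
    (fun m => dd_bound _ (by linarith) _ m s (by linarith) (by linarith))

lemma E_diff : DifferentiableOn ℂ (fun s => ∑' m, dd m s) {s | 0 < s.re} := by
  intro s hs
  change 0 < s.re at hs
  have hopen : IsOpen {w : ℂ | s.re / 2 < w.re ∧ ‖w‖ < ‖s‖ + 1} :=
    (isOpen_lt continuous_const Complex.continuous_re).inter
      (isOpen_lt continuous_norm continuous_const)
  have := differentiableOn_tsum_of_summable_norm (F := dd)
    (dd_summable_bound (s.re / 2) (by linarith) (‖s‖ + 1)) (fun m => ?_) hopen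
    (fun m w hw => dd_bound _ (by linarith) _ m w hw.1 hw.2)
  · exact (this.differentiableAt (hopen.mem_nhds ⟨by linarith, by linarith⟩)).differentiableWithinAt
  · intro w hw
    have h1 : ((2 * m + 1 : ℝ) : ℂ) ≠ 0 := by
      exact_mod_cast (by positivity : (2 * m + 1 : ℝ) ≠ 0)
    have h2 : ((2 * m + 1 + 1 : ℝ) : ℂ) ≠ 0 := by
      exact_mod_cast (by positivity : (2 * m + 1 + 1 : ℝ) ≠ 0)
    unfold dd
    apply DifferentiableAt.differentiableWithinAt
    apply DifferentiableAt.sub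
    · exact (differentiableAt_id.neg).const_cpow (Or.inl h1)
    · exact (differentiableAt_id.neg).const_cpow (Or.inl h2)

lemma E_eq_of_one_lt (s : ℂ) (hs : 1 < s.re) :
    ∑' m, dd m s = (1 - 2 * 2 ^ (-s)) * riemannZeta s := by
  set f : ℕ → ℂ := fun n => ((n : ℂ) + 1) ^ (-s) with hf
  have hz : riemannZeta s = ∑' n, f n := by
    rw [zeta_eq_tsum_one_div_nat_add_one_cpow hs]
    congr 1 with n
    simp [hf, cpow_neg]
  have hsum : Summable f := by
    have := (summable_nat_add_iff 1).2 (Complex.summable_one_div_nat_cpow.2 hs)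
    refine this.congr fun n => ?_
    simp [hf, cpow_neg]
  have h0 : Summable fun m => f (2 * m) := hsum.comp_injective (fun a b h => by simpa using h)
  have h1 : Summable fun m => f (2 * m + 1) := hsum.comp_injective (fun a b h => by simpa using h)
  have h2 : ∑' m, f (2 * m + 1) = 2 ^ (-s) * ∑' n, f n := by
    rw [← tsum_mul_left]
    congr 1 with n
    simp only [hf]
    have := Complex.mul_cpow_ofReal_nonneg (a := 2) (b := (n : ℝ) + 1) (by norm_num) (by positivity) (-s)
    push_cast at this ⊢
    rw [← this]
    congr 1
    ring
  have h3 := tsum_even_add_odd h0 h1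
  have h4 : ∑' m, dd m s = ∑' m, f (2 * m) - ∑' m, f (2 * m + 1) := by
    rw [← h0.tsum_sub h1]
    congr 1 with m
    simp [dd, hf]
  rw [h4, hz, ← h3, eq_sub_of_add_eq h3, h2]
  ring

lemma E_eq (s : ℂ) (hs : 0 < s.re) :
    (s - 1) * ∑' m, dd m s = (1 - 2 * 2 ^ (-s)) * riemannZeta₁ s := by
  have hopen : IsOpen {w : ℂ | 0 < w.re} := isOpen_lt continuous_const Complex.continuous_re
  have hopen1 : IsOpen {w : ℂ | 1 < w.re} := isOpen_lt continuous_const Complex.continuous_re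
  have hF : DifferentiableOn ℂ (fun s : ℂ => (s - 1) * ∑' m, dd m s) {w : ℂ | 0 < w.re} :=
    DifferentiableOn.mul (by fun_prop) E_diff
  have hG : Differentiable ℂ (fun s : ℂ => (1 - 2 * 2 ^ (-s)) * riemannZeta₁ s) := by
    apply Differentiable.mul _ differentiable_riemannZeta₁
    have : Differentiable ℂ (fun s : ℂ => (2 : ℂ) ^ (-s)) :=
      fun s => (differentiableAt_id.neg).const_cpow (Or.inl two_ne_zero)
    fun_prop
  refine (hF.analyticOnNhd hopen).eqOn_of_preconnected_of_eventuallyEq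
    (hG.differentiableOn.analyticOnNhd hopen) (convex_halfSpace_re_gt 0).isPreconnected
    (z₀ := 2) (by simp) ?_ hs
  filter_upwards [hopen1.mem_nhds (by simp : (2 : ℂ) ∈ {w : ℂ | 1 < w.re})] with w hw
  have hw1 : w ≠ 1 := by rintro rfl; simp at hw
  rw [E_eq_of_one_lt w hw, riemannZeta_eq_inv_sub_mul hw1]
  have : w - 1 ≠ 0 := sub_ne_zero.2 hw1
  field_simp

lemma E_zero (s : ℂ) (hs : 0 < s.re) (hs1 : s ≠ 1) (hz : riemannZeta s = 0) :
    ∑' m, dd m s = 0 := by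
  have h1 : s - 1 ≠ 0 := sub_ne_zero.2 hs1
  have h := E_eq s hs
  rw [riemannZeta_eq_inv_sub_mul hs1] at hz
  have : riemannZeta₁ s = 0 := by simpa [h1] using hz
  rw [this] at h
  simpa [h1] using h

noncomputable def bb (s : ℂ) (n : ℕ) : ℂ := (((n : ℝ) + 1 : ℝ) : ℂ) ^ (-s)
noncomputable def aa (s : ℂ) (n : ℕ) : ℂ := (-1) ^ n * bb s n
noncomputable def SS (s : ℂ) (N : ℕ) : ℂ := ∑ i ∈ range N, aa s i
noncomputable def tt (x : ℝ) (n : ℕ) : ℝ := ((n : ℝ) + 1) ^ (-x)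

lemma norm_bb (s : ℂ) (n : ℕ) : ‖bb s n‖ = tt s.re n := by
  rw [bb, Complex.norm_cpow_eq_rpow_re_of_pos (by positivity)]; rfl

lemma norm_aa (s : ℂ) (n : ℕ) : ‖aa s n‖ = tt s.re n := by
  simp [aa, norm_bb]

lemma tt_pos (x : ℝ) (n : ℕ) : 0 < tt x n := by unfold tt; positivity

lemma tt_anti (x : ℝ) (hx : 0 < x) : Antitone (tt x) := by
  intro m n h
  unfold tt
  apply Real.rpow_le_rpow_of_nonpos (by positivity) (by gcongr) (by linarith)

lemma tt_tendsto (x : ℝ) (hx : 0 < x) : Tendsto (tt x) atTop (nhds 0) :=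
  (tendsto_rpow_neg_atTop hx).comp
    (tendsto_atTop_add_const_right _ 1 tendsto_natCast_atTop_atTop)

lemma SS_diff (s : ℂ) (hs : 0 < s.re) (N m : ℕ) :
    ‖SS s (N + 2 * m) - SS s N‖ ≤ ‖s‖ / s.re * (tt s.re N - tt s.re (N + 2 * m)) := by
  induction m with
  | zero => simp
  | succ m ih =>
    have e : SS s (N + 2 * (m + 1)) - SS s N = (SS s (N + 2 * m) - SS s N)
        + (-1) ^ (N + 2 * m) * (bb s (N + 2 * m) - bb s (N + 2 * m + 1)) := by
      rw [show N + 2 * (m + 1) = N + 2 * m + 1 + 1 by ring]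
      simp only [SS, sum_range_succ, aa, pow_succ]
      ring
    have h1 := aux_bound1 (((N + 2 * m : ℕ) : ℝ) + 1) (by positivity) s hs
    have h2 : ‖bb s (N + 2 * m) - bb s (N + 2 * m + 1)‖ ≤
        ‖s‖ / s.re * (tt s.re (N + 2 * m) - tt s.re (N + 2 * m + 1)) := by
      simpa [bb, tt] using h1
    have h3 : tt s.re (N + 2 * (m + 1)) ≤ tt s.re (N + 2 * m + 1) :=
      tt_anti _ hs (by omega)
    rw [e]
    have hC : 0 ≤ ‖s‖ / s.re := by positivity
    refine (norm_add_le _ _).trans ?_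
    rw [norm_mul, norm_pow, norm_neg, norm_one, one_pow, one_mul]
    have h4 : N + 2 * (m + 1) = N + 2 * m + 1 + 1 := by ring
    nlinarith [mul_le_mul_of_nonneg_left h3 hC]

lemma SS_even (s : ℂ) (M : ℕ) : SS s (2 * M) = ∑ m ∈ range M, dd m s := by
  induction M with
  | zero => simp [SS]
  | succ M ih =>
    rw [sum_range_succ, ← ih, show 2 * (M + 1) = 2 * M + 1 + 1 by ring]
    simp only [SS, sum_range_succ, aa, dd, bb, pow_succ, pow_mul]
    push_cast
    ring_nf

lemma SS_even_tendsto (s : ℂ) (hs : 0 < s.re) (hs1 : s ≠ 1) (hz : riemannZeta s = 0) :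
    Tendsto (fun M => SS s (2 * M)) atTop (nhds 0) := by
  have := (dd_summable s hs).hasSum.tendsto_sum_nat
  rw [E_zero s hs hs1 hz] at this
  simpa only [SS_even] using this

lemma SS_bound_even (s : ℂ) (hs : 0 < s.re) (hs1 : s ≠ 1) (hz : riemannZeta s = 0) (M : ℕ) :
    ‖SS s (2 * M)‖ ≤ ‖s‖ / s.re * tt s.re (2 * M) := by
  have h := (((SS_even_tendsto s hs hs1 hz).comp (tendsto_add_atTop_nat M)).sub_const
    (SS s (2 * M))).norm
  rw [zero_sub, norm_neg] at h
  refine le_of_tendsto h (Eventually.of_forall fun m => ?_)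
  have h1 := SS_diff s hs (2 * M) m
  have hC : 0 ≤ ‖s‖ / s.re := by positivity
  simp only [Function.comp]
  rw [show 2 * (m + M) = 2 * M + 2 * m by ring]
  nlinarith [mul_nonneg hC (tt_pos s.re (2 * M + 2 * m)).le]

lemma SS_tendsto (s : ℂ) (hs : 0 < s.re) (hs1 : s ≠ 1) (hz : riemannZeta s = 0) :
    ∃ C : ℝ, 0 ≤ C ∧ ∀ N, ‖SS s (N + 1)‖ ≤ C * tt s.re N := by
  refine ⟨‖s‖ / s.re + 1, by positivity, fun N => ?_⟩
  have hC : 0 ≤ ‖s‖ / s.re := by positivity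
  have ht := (tt_pos s.re N).le
  rcases Nat.even_or_odd' N with ⟨M, rfl | rfl⟩
  · have h1 := SS_bound_even s hs hs1 hz M
    have : SS s (2 * M + 1) = SS s (2 * M) + aa s (2 * M) := by simp [SS, sum_range_succ]
    rw [this]
    refine (norm_add_le _ _).trans ?_
    rw [norm_aa]
    linarith
  · have h1 := SS_bound_even s hs hs1 hz (M + 1)
    rw [show 2 * M + 1 + 1 = 2 * (M + 1) by ring]
    refine h1.trans ?_
    have := tt_anti _ hs (show 2 * M + 1 ≤ 2 * (M + 1) by omega)
    nlinarith [mul_le_mul_of_nonneg_left this hC]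

lemma re_bb (x y : ℝ) (s : ℂ) (hs : s = x + y * I) (n k : ℕ) :
    (bb s n * (starRingEnd ℂ) (bb s (n + k))).re =
      Real.cos (y * Real.log (1 + (k : ℝ) / ((n : ℝ) + 1))) /
            (((n : ℝ) + 1) * (((n : ℝ) + 1) + k)) ^ x := by
  have hp : (0 : ℝ) < (n : ℝ) + 1 := by positivity
  have hq : (0 : ℝ) < (n : ℝ) + 1 + k := by positivity
  have key : ∀ p : ℝ, 0 < p → (p : ℂ) ^ (-s) =
      Complex.exp ((-(x * Real.log p) : ℝ) + (-(y * Real.log p) : ℝ) * I) := by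
    intro p hp
    rw [Complex.cpow_def_of_ne_zero (by exact_mod_cast hp.ne'), ← Complex.ofReal_log hp.le, hs]
    congr 1
    push_cast
    ring
  have e1 : bb s (n + k) = (((n : ℝ) + 1 + k : ℝ) : ℂ) ^ (-s) := by
    unfold bb
    congr 2
    push_cast
    ring
  have e2 : Real.log (1 + (k : ℝ) / ((n : ℝ) + 1)) =
      Real.log ((n : ℝ) + 1 + k) - Real.log ((n : ℝ) + 1) := by
    rw [← Real.log_div hq.ne' hp.ne']
    congr 1
    field_simp
  rw [e1, bb, key _ hp, key _ hq, ← Complex.exp_conj, ← Complex.exp_add, e2, Complex.exp_re,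
    Real.rpow_def_of_pos (by positivity), Real.log_mul hp.ne' hq.ne', div_eq_mul_inv,
    ← Real.exp_neg, mul_comm]
  congr 1
  · congr 1
    simp
    ring
  · congr 1
    simp
    ring

lemma re_aa (s : ℂ) (n k : ℕ) :
    (aa s n * (starRingEnd ℂ) (aa s (n + k))).re =
      (-1) ^ k * (bb s n * (starRingEnd ℂ) (bb s (n + k))).re := by
  have : aa s n * (starRingEnd ℂ) (aa s (n + k)) =
      (((-1 : ℝ) ^ k : ℝ) : ℂ) * (bb s n * (starRingEnd ℂ) (bb s (n + k))) := by
    have h : ((-1 : ℂ) ^ n) * (-1) ^ n = 1 := by rw [← mul_pow]; simp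
    simp only [aa, map_mul, map_pow, map_neg, map_one, pow_add]
    push_cast
    linear_combination (bb s n * (starRingEnd ℂ) (bb s (n + k)) * (-1) ^ k) * h
  rw [this, Complex.re_ofReal_mul]

lemma sum_aa (s : ℂ) (n K : ℕ) : ∑ k ∈ Icc 1 K, aa s (n + k) = SS s (n + K + 1) - SS s (n + 1) := by
  induction K with
  | zero => simp
  | succ K ih =>
    rw [Finset.sum_Icc_succ_top (by omega), ih, show n + (K + 1) + 1 = (n + K + 1) + 1 by ring]
    simp only [SS, sum_range_succ, show n + (K + 1) = n + K + 1 by ring]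
    ring

lemma tt_sq (x : ℝ) (n : ℕ) : tt x n * tt x n = ((n : ℝ) + 1) ^ (-(2 * x)) := by
  unfold tt
  rw [← Real.rpow_add (by positivity)]
  congr 1
  ring

lemma tt_sq_summable (x : ℝ) (hx : 1 / 2 < x) : Summable (fun n => tt x n * tt x n) := by
  have := (summable_nat_add_iff 1).2 ((Real.summable_nat_rpow (p := -(2 * x))).2 (by linarith))
  refine this.congr fun n => ?_
  rw [tt_sq]
  push_cast
  rfl

/-- If `s = x + iy` with `1/2 < x < 1` is a zero of the Riemann zeta function, then
`Σ_{k≥1} (−1)^{k+1} Z_{k+1}(x,y) = 1/2`, in any ordering under which the outer series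
converges (here: as the limit of its partial sums), where
`Z_{k+1}(x,y) = (1/ζ(2x)) Σ_{n≥1} cos(y log(1+k/n))/(n(n+k))^x` and `ζ(2x)` is given
by its Dirichlet series (convergent since `2x > 1`). -/
theorem stmt_5 (x y : ℝ) (hx1 : 1 / 2 < x) (hx2 : x < 1) (s : ℂ) (hs : s = x + y * I)
    (hzero : riemannZeta s = 0) (L : ℝ)
    (hL : Tendsto (fun K : ℕ => ∑ k ∈ Icc 1 K, (-1 : ℝ) ^ (k + 1) *
        ((1 / ∑' n : ℕ, ((n : ℝ) + 1) ^ (-(2 * x))) *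
          ∑' n : ℕ, Real.cos (y * Real.log (1 + (k : ℝ) / ((n : ℝ) + 1))) /
            (((n : ℝ) + 1) * (((n : ℝ) + 1) + k)) ^ x)) atTop (nhds L)) :
    L = 1 / 2 := by
  have hre : s.re = x := by simp [hs]
  have hpos : 0 < s.re := by linarith
  have hs1 : s ≠ 1 := by
    rintro rfl
    simp at hre
    linarith
  obtain ⟨C, hC0, hC⟩ := SS_tendsto s hpos hs1 hzero
  rw [hre] at hC
  have hx0 : 0 < x := by linarith
  have hS1 : Tendsto (fun N => SS s (N + 1)) atTop (nhds 0) := by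
    apply squeeze_zero_norm hC
    simpa using (tt_tendsto x hx0).const_mul C
  have hS : Tendsto (fun N => SS s N) atTop (nhds 0) := (tendsto_add_atTop_iff_nat 1).1 hS1
  have hsq := tt_sq_summable x hx1
  set Z : ℝ := ∑' n : ℕ, ((n : ℝ) + 1) ^ (-(2 * x)) with hZ
  have hZ' : Z = ∑' n, tt x n * tt x n := by simp only [hZ, tt_sq]
  have hZpos : 0 < Z := by
    rw [hZ']
    exact hsq.tsum_pos (fun n => (mul_pos (tt_pos x n) (tt_pos x n)).le) 0
      (mul_pos (tt_pos x 0) (tt_pos x 0))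
  -- summability in n of each correlation
  have hsum : ∀ k, Summable fun n => (aa s n * (starRingEnd ℂ) (aa s (n + k))).re := by
    intro k
    refine Summable.of_norm_bounded hsq fun n => ?_
    refine (Complex.abs_re_le_norm _).trans ?_
    rw [norm_mul, RCLike.norm_conj, norm_aa, norm_aa, hre]
    exact mul_le_mul_of_nonneg_left (tt_anti x hx0 (by omega)) (tt_pos x n).le
  -- partial sums
  have hpart : ∀ K, ∑ k ∈ Icc 1 K, ∑' n, (aa s n * (starRingEnd ℂ) (aa s (n + k))).re =
      ∑' n, (aa s n * (starRingEnd ℂ) (SS s (n + K + 1) - SS s (n + 1))).re := by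
    intro K
    rw [← Summable.tsum_finsetSum (fun k _ => hsum k)]
    congr 1 with n
    rw [← sum_aa, map_sum, mul_sum, Complex.re_sum]
  -- limit
  have hlim : Tendsto (fun K => ∑' n, (aa s n *
      (starRingEnd ℂ) (SS s (n + K + 1) - SS s (n + 1))).re) atTop
      (nhds (∑' n, (aa s n * (starRingEnd ℂ) (0 - SS s (n + 1))).re)) := by
    refine tendsto_tsum_of_dominated_convergence (hsq.mul_left (2 * C)) (fun n => ?_)
      (Eventually.of_forall fun K n => ?_)
    · have h1 : Tendsto (fun K => SS s (n + K + 1)) atTop (nhds 0) :=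
        hS.comp (tendsto_atTop_mono (fun K => by simp only [id]; omega) tendsto_id)
      have h2 : Continuous fun w : ℂ => (aa s n * (starRingEnd ℂ) (w - SS s (n + 1))).re := by
        have := Complex.continuous_conj
        fun_prop
      exact (h2.tendsto 0).comp h1
    · refine (Complex.abs_re_le_norm _).trans ?_
      rw [norm_mul, RCLike.norm_conj, norm_aa, hre]
      have h1 := hC (n + K)
      have h2 := hC n
      have h3 := mul_le_mul_of_nonneg_left (tt_anti x hx0 (show n ≤ n + K by omega)) hC0
      have h4 := norm_sub_le (SS s (n + K + 1)) (SS s (n + 1))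
      have h5 : ‖SS s (n + K + 1) - SS s (n + 1)‖ ≤ 2 * C * tt x n := by linarith
      have := mul_le_mul_of_nonneg_left h5 (tt_pos x n).le
      linarith
  -- telescoping
  have hid : ∀ n, (aa s n * (starRingEnd ℂ) (0 - SS s (n + 1))).re =
      -(1 / 2) * (‖SS s (n + 1)‖ ^ 2 - ‖SS s n‖ ^ 2 + tt x n * tt x n) := by
    intro n
    have e : SS s n = SS s (n + 1) - aa s n := by simp [SS, sum_range_succ]
    have e2 : tt x n * tt x n = ‖aa s n‖ ^ 2 := by rw [norm_aa, hre]; ring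
    rw [e, e2, ← Complex.normSq_eq_norm_sq, ← Complex.normSq_eq_norm_sq,
      ← Complex.normSq_eq_norm_sq]
    simp only [Complex.normSq_apply, Complex.mul_re, Complex.sub_re, Complex.sub_im,
      Complex.conj_re, Complex.conj_im, Complex.zero_re, Complex.zero_im]
    ring
  have hsumlim : Summable fun n => (aa s n * (starRingEnd ℂ) (0 - SS s (n + 1))).re := by
    refine Summable.of_norm_bounded (hsq.mul_left C) fun n => ?_
    refine (Complex.abs_re_le_norm _).trans ?_
    rw [norm_mul, RCLike.norm_conj, norm_aa, hre, zero_sub, norm_neg]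
    have := mul_le_mul_of_nonneg_left (hC n) (tt_pos x n).le
    linarith
  have hval : ∑' n, (aa s n * (starRingEnd ℂ) (0 - SS s (n + 1))).re = -(1 / 2) * Z := by
    refine tendsto_nhds_unique hsumlim.hasSum.tendsto_sum_nat ?_
    have h1 : ∀ N, ∑ n ∈ range N, (aa s n * (starRingEnd ℂ) (0 - SS s (n + 1))).re =
        -(1 / 2) * (‖SS s N‖ ^ 2 + ∑ n ∈ range N, tt x n * tt x n) := by
      intro N
      rw [sum_congr rfl (fun n _ => hid n), ← mul_sum, sum_add_distrib,
        sum_range_sub (fun n => ‖SS s n‖ ^ 2)]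
      simp [SS]
    simp only [h1]
    have h2 := ((hS.norm.pow 2).add hsq.hasSum.tendsto_sum_nat).const_mul (-(1 / 2))
    rw [← hZ'] at h2
    simpa using h2
  rw [hval] at hlim
  have hfin := hlim.const_mul (-(1 / Z))
  refine (tendsto_nhds_unique hL (hfin.congr fun K => ?_)).trans ?_
  · rw [← hpart, mul_sum]
    refine sum_congr rfl fun k _ => ?_
    simp only [re_aa, re_bb x y s hs, tsum_mul_left]
    ring
  · field_simp
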